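/- Let a, b, c ≥ 0 with c > 0. Then there exists a function G : ℝ → ℝ, twice continuously differentiable on [0,1], such that G(0) = 0, G(1) = c, G'(0) = a, G'(1) = b, G'(t) ≥ 0 for all t ∈ [0,1], and sup_{t ∈ [0,1]} |G''(t)| ≤ 1.2 · M*(a,b,c), where M*(a,b,c) := (a² + b²)/(2c) if 2c(a+b) ≤ a² + b² and a + b > 0, and M*(a,b,c) := |2c − a − b| + √((2c − a − b)² + (b − a)²) otherwise. -/

import Mathlib

open Classical in
/-- The optimal `C^{1,1}` curvature for the two-point monotone Hermite problem with
data `a, b ≥ 0`, `c > 0`. -/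
noncomputable def MstarR (a b c : ℝ) : ℝ :=
  if 2 * c * (a + b) ≤ a ^ 2 + b ^ 2 ∧ 0 < a + b then (a ^ 2 + b ^ 2) / (2 * c)
  else |2 * c - a - b| + Real.sqrt ((2 * c - a - b) ^ 2 + (b - a) ^ 2)

/-- `c` is the increment over `[0,1]` of a monotone `C²` function with end slopes `a`, `b` and
second derivative bounded by `L`. -/
def IsMonotoneHermiteIncrement (a b L c : ℝ) : Prop :=
  ∃ G g g2 : ℝ → ℝ,
    (∀ t, HasDerivAt G (g t) t) ∧ (∀ t, HasDerivAt g (g2 t) t) ∧ Continuous g2 ∧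
    G 1 - G 0 = c ∧ g 0 = a ∧ g 1 = b ∧
    (∀ t ∈ Set.Icc (0:ℝ) 1, 0 ≤ g t) ∧ (∀ t ∈ Set.Icc (0:ℝ) 1, |g2 t| ≤ L)

theorem IsMonotoneHermiteIncrement.convex {a b L x y : ℝ}
    (hx : IsMonotoneHermiteIncrement a b L x) (hy : IsMonotoneHermiteIncrement a b L y)
    {s r : ℝ} (hs : 0 ≤ s) (hr : 0 ≤ r) (hsr : s + r = 1) :
    IsMonotoneHermiteIncrement a b L (s * x + r * y) := by
  obtain ⟨F, f, f2, hF, hf, cf, iF, f0, f1, fn, fb⟩ := hx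
  obtain ⟨G, g, g2, hG, hg, cg, iG, g0, g1, gn, gb⟩ := hy
  refine ⟨fun t => s * F t + r * G t, fun t => s * f t + r * g t, fun t => s * f2 t + r * g2 t,
    fun t => ((hF t).const_mul s).add ((hG t).const_mul r),
    fun t => ((hf t).const_mul s).add ((hg t).const_mul r), by fun_prop, ?_, ?_, ?_, ?_, ?_⟩
  · rw [← iF, ← iG]; ring
  · simp only [f0, g0, ← add_mul, hsr, one_mul]
  · simp only [f1, g1, ← add_mul, hsr, one_mul]
  · exact fun t ht => add_nonneg (mul_nonneg hs (fn t ht)) (mul_nonneg hr (gn t ht))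
  · intro t ht
    calc |s * f2 t + r * g2 t| ≤ |s * f2 t| + |r * g2 t| := abs_add_le _ _
      _ = s * |f2 t| + r * |g2 t| := by rw [abs_mul, abs_mul, abs_of_nonneg hs, abs_of_nonneg hr]
      _ ≤ s * L + r * L := by gcongr <;> [exact fb t ht; exact gb t ht]
      _ = L := by rw [← add_mul, hsr, one_mul]

theorem IsMonotoneHermiteIncrement.of_mem_Icc {a b L x y c : ℝ}
    (hx : IsMonotoneHermiteIncrement a b L x) (hy : IsMonotoneHermiteIncrement a b L y)
    (hc : c ∈ Set.Icc x y) : IsMonotoneHermiteIncrement a b L c := by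
  obtain ⟨s, r, hs, hr, hsr, rfl⟩ := Icc_subset_segment (𝕜 := ℝ) hc
  exact hx.convex hy hs hr hsr

theorem isMonotoneHermiteIncrement_linear {a b L : ℝ} (ha : 0 ≤ a) (hb : 0 ≤ b)
    (h : |b - a| ≤ L) : IsMonotoneHermiteIncrement a b L ((a + b) / 2) := by
  refine ⟨fun t => a * t + (b - a) / 2 * t ^ 2, fun t => a + (b - a) * t, fun _ => b - a,
    fun t => ?_, fun t => ?_, continuous_const, by ring, by ring, by ring, ?_, fun _ _ => h⟩
  · refine HasDerivAt.congr_deriv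
      (((hasDerivAt_id' t).const_mul a).add ((hasDerivAt_pow 2 t).const_mul ((b - a) / 2))) ?_
    push_cast
    ring
  · refine HasDerivAt.congr_deriv (((hasDerivAt_id' t).const_mul (b - a)).const_add a) ?_
    ring
  · rintro t ⟨h0, h1⟩
    nlinarith [mul_nonneg ha (sub_nonneg.2 h1), mul_nonneg hb h0]

theorem hasDerivAt_max_zero_pow (n : ℕ) (x : ℝ) :
    HasDerivAt (fun u : ℝ => max u 0 ^ (n + 2)) ((n + 2) * max x 0 ^ (n + 1)) x := by
  rcases lt_trichotomy x 0 with hx | rfl | hx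
  · rw [max_eq_right hx.le, zero_pow (by omega), mul_zero]
    refine (hasDerivAt_const x (0:ℝ)).congr_of_eventuallyEq ?_
    filter_upwards [Iio_mem_nhds hx] with u hu
    rw [max_eq_right (le_of_lt hu), zero_pow (by omega)]
  · rw [max_self, zero_pow (by omega), mul_zero, hasDerivAt_iff_isLittleO]
    simp only [max_self, zero_pow (Nat.succ_ne_zero _), sub_zero, smul_zero]
    have h : (fun u : ℝ => max u 0 ^ (n + 2)) =O[nhds 0] fun u : ℝ => u ^ (n + 2) := by
      refine Asymptotics.IsBigO.of_bound 1 (Filter.Eventually.of_forall fun u => ?_)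
      rw [one_mul, norm_pow, norm_pow]
      gcongr
      rw [Real.norm_eq_abs, Real.norm_eq_abs, abs_of_nonneg (le_max_right _ _)]
      exact max_le (le_abs_self u) (abs_nonneg u)
    exact h.trans_isLittleO (Asymptotics.isLittleO_pow_id (by omega))
  · rw [max_eq_left hx.le]
    have h := hasDerivAt_pow (n + 2) x
    push_cast at h
    refine h.congr_of_eventuallyEq ?_
    filter_upwards [Ioi_mem_nhds hx] with u hu
    rw [max_eq_left (le_of_lt hu)]

/-- A `C¹` profile vanishing for `u ≤ 0`, with value `1` at `1`, slope at most `6/5` and mass at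
most `1/2` on `[0,1]`; `Q` is its antiderivative and `r` its derivative. -/
theorem exists_ramp_profile : ∃ Q q r : ℝ → ℝ,
    (∀ u, HasDerivAt Q (q u) u) ∧ (∀ u, HasDerivAt q (r u) u) ∧ Continuous r ∧
    (∀ u ≤ 0, Q u = 0 ∧ q u = 0 ∧ r u = 0) ∧ q 1 = 1 ∧ Q 1 ≤ 1 / 2 ∧
    (∀ u, 0 ≤ r u ∧ r u ≤ 6 / 5) := by
  refine ⟨fun u => 3 / 5 * (max u 0 ^ 3 - max (u - 1 / 3) 0 ^ 3),
    fun u => 9 / 5 * (max u 0 ^ 2 - max (u - 1 / 3) 0 ^ 2),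
    fun u => 18 / 5 * (max u 0 - max (u - 1 / 3) 0), fun u => ?_, fun u => ?_, by fun_prop,
    fun u hu => ?_, ?_, ?_, fun u => ?_⟩
  · refine HasDerivAt.congr_deriv (((hasDerivAt_max_zero_pow 1 u).sub
      ((hasDerivAt_max_zero_pow 1 (u - 1 / 3)).comp_sub_const u (1 / 3))).const_mul (3 / 5)) ?_
    push_cast
    ring
  · refine HasDerivAt.congr_deriv (((hasDerivAt_max_zero_pow 0 u).sub
      ((hasDerivAt_max_zero_pow 0 (u - 1 / 3)).comp_sub_const u (1 / 3))).const_mul (9 / 5)) ?_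
    push_cast
    ring
  · simp only [max_eq_right hu, max_eq_right (show u - 1 / 3 ≤ 0 by linarith)]
    norm_num
  · norm_num
  · norm_num
  · rcases max_cases u 0 with ⟨h, _⟩ | ⟨h, _⟩ <;>
      rcases max_cases (u - 1 / 3) 0 with ⟨h', _⟩ | ⟨h', _⟩ <;>
      simp only [h, h'] <;> constructor <;> linarith

/-- A `C¹` descent from `α` to `0` on `[0,α]` with slope at least `-6/5`. -/
theorem exists_descent {α : ℝ} (h0 : 0 ≤ α) (h1 : α ≤ 1) : ∃ H h k : ℝ → ℝ,
    (∀ t, HasDerivAt H (h t) t) ∧ (∀ t, HasDerivAt h (k t) t) ∧ Continuous k ∧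
    h 0 = α ∧ (∀ t, α ≤ t → h t = 0 ∧ k t = 0) ∧ H 1 - H 0 ≤ α ^ 2 / 2 ∧
    (∀ t, |k t| ≤ 6 / 5) ∧ (∀ t, 0 ≤ t → 0 ≤ h t ∧ h t ≤ α) := by
  rcases h0.eq_or_lt with rfl | hα
  · exact ⟨0, 0, 0, fun t => hasDerivAt_const t 0, fun t => hasDerivAt_const t 0, continuous_zero,
      rfl, by simp, by simp, fun t => by norm_num, by simp⟩
  obtain ⟨Q, q, r, hQ, hq, cr, hz, q1, Q1, hr⟩ := exists_ramp_profile
  have hu : ∀ t, HasDerivAt (fun t : ℝ => 1 - t / α) (-(1 / α)) t := fun t =>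
    ((hasDerivAt_id' t).div_const α).const_sub 1
  have hd : ∀ t, HasDerivAt (fun t => α * q (1 - t / α)) (-r (1 - t / α)) t := fun t => by
    refine HasDerivAt.congr_deriv (((hq (1 - t / α)).comp t (hu t)).const_mul α) ?_
    field_simp
  have hanti : Antitone fun t => α * q (1 - t / α) :=
    antitone_of_hasDerivAt_nonpos hd fun t => neg_nonpos.2 (hr _).1
  have hzero : ∀ t, α ≤ t → 1 - t / α ≤ 0 := fun t ht => by
    rw [sub_nonpos, one_le_div hα]; exact ht
  have hval : α * q (1 - 0 / α) = α := by simp [q1]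
  refine ⟨fun t => -(α ^ 2) * Q (1 - t / α), fun t => α * q (1 - t / α), fun t => -r (1 - t / α),
    fun t => ?_, hd, by fun_prop, hval, fun t ht => ?_, ?_, fun t => ?_, fun t ht => ⟨?_, ?_⟩⟩
  · refine HasDerivAt.congr_deriv (((hQ (1 - t / α)).comp t (hu t)).const_mul (-(α ^ 2))) ?_
    field_simp
  · simp [hz _ (hzero t ht)]
  · simp only [(hz _ (hzero 1 h1)).1, zero_div, sub_zero]
    nlinarith [sq_nonneg α]
  · rw [abs_neg, abs_of_nonneg (hr _).1]
    exact (hr _).2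
  · have := hanti (le_max_left t α)
    simp only [(hz _ (hzero _ (le_max_right t α))).2.1, mul_zero] at this
    exact this
  · exact (hanti ht).trans_eq hval

/-- A `C¹` descent from `α` to `0` followed by a `C¹` ascent from `0` to `β`. -/
theorem exists_valley {α β : ℝ} (hα : 0 ≤ α) (hβ : 0 ≤ β) (hαβ : α + β ≤ 1) : ∃ H h k : ℝ → ℝ,
    (∀ t, HasDerivAt H (h t) t) ∧ (∀ t, HasDerivAt h (k t) t) ∧ Continuous k ∧
    h 0 = α ∧ h 1 = β ∧ H 1 - H 0 ≤ (α ^ 2 + β ^ 2) / 2 ∧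
    (∀ t ∈ Set.Icc (0:ℝ) 1, |k t| ≤ 6 / 5) ∧
    (∀ t ∈ Set.Icc (0:ℝ) 1, 0 ≤ h t ∧ h t ≤ max α β) := by
  obtain ⟨F, f, m, hF, hf, cm, f0, fz, Fi, mb, fb⟩ := exists_descent hα (by linarith)
  obtain ⟨G, g, n, hG, hg, cn, g0, gz, Gi, nb, gb⟩ := exists_descent hβ (by linarith)
  have hs : ∀ t, HasDerivAt (fun t : ℝ => 1 - t) (-1) t := fun t => (hasDerivAt_id' t).const_sub 1
  have split : ∀ t, (f t = 0 ∧ m t = 0) ∨ (g (1 - t) = 0 ∧ n (1 - t) = 0) := fun t =>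
    (le_total α t).imp (fz t) fun ht => gz _ (by linarith)
  refine ⟨fun t => F t - G (1 - t), fun t => f t + g (1 - t), fun t => m t - n (1 - t),
    fun t => ?_, fun t => ?_, by fun_prop, ?_, ?_, ?_, fun t ht => ?_, fun t ht => ?_⟩
  · refine HasDerivAt.congr_deriv ((hF t).sub ((hG (1 - t)).comp t (hs t))) ?_
    ring
  · refine HasDerivAt.congr_deriv ((hf t).add ((hg (1 - t)).comp t (hs t))) ?_
    ring
  · simp [f0, (gz 1 (by linarith)).1]
  · simp [g0, (fz 1 (by linarith)).1]
  · simp only [sub_self, sub_zero]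
    linarith
  · rcases split t with ⟨_, h⟩ | ⟨_, h⟩
    · simpa [h] using nb (1 - t)
    · simpa [h] using mb t
  · rcases split t with ⟨h, _⟩ | ⟨h, _⟩
    · simpa [h] using ⟨(gb _ (sub_nonneg.2 ht.2)).1, Or.inr (gb _ (sub_nonneg.2 ht.2)).2⟩
    · simpa [h] using ⟨(fb t ht.1).1, Or.inl (fb t ht.1).2⟩

theorem exists_isMonotoneHermiteIncrement_le {P M α β : ℝ} (hP : 0 ≤ P) (hM : 0 ≤ M)
    (hα : 0 ≤ α) (hβ : 0 ≤ β) (hαβ : α + β ≤ 1) :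
    ∃ x ≤ P + M * ((α ^ 2 + β ^ 2) / 2),
      IsMonotoneHermiteIncrement (P + M * α) (P + M * β) (1.2 * M) x := by
  obtain ⟨H, h, k, hH, hh, ck, h0, h1, Hi, kb, hb⟩ := exists_valley hα hβ hαβ
  refine ⟨P + M * (H 1 - H 0), by gcongr, fun t => P * t + M * H t, fun t => P + M * h t,
    fun t => M * k t, fun t => ?_, fun t => ((hh t).const_mul M).const_add P, by fun_prop,
    by ring, by simp only [h0], by simp only [h1], fun t ht => ?_, fun t ht => ?_⟩
  · refine HasDerivAt.congr_deriv
      (((hasDerivAt_id' t).const_mul P).add ((hH t).const_mul M)) ?_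
    ring
  · exact add_nonneg hP (mul_nonneg hM (hb t ht).1)
  · rw [abs_mul, abs_of_nonneg hM]
    nlinarith [kb t ht]

theorem exists_isMonotoneHermiteIncrement_ge {P M α β : ℝ} (hM : 0 ≤ M)
    (hα : 0 ≤ α) (hβ : 0 ≤ β) (hαβ : α + β ≤ 1) (hPα : 0 ≤ P - M * α) (hPβ : 0 ≤ P - M * β) :
    ∃ x ≥ P - M * ((α ^ 2 + β ^ 2) / 2),
      IsMonotoneHermiteIncrement (P - M * α) (P - M * β) (1.2 * M) x := by
  obtain ⟨H, h, k, hH, hh, ck, h0, h1, Hi, kb, hb⟩ := exists_valley hα hβ hαβ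
  refine ⟨P - M * (H 1 - H 0), by gcongr, fun t => P * t - M * H t, fun t => P - M * h t,
    fun t => -(M * k t), fun t => ?_, fun t => ((hh t).const_mul M).const_sub P, by fun_prop,
    by ring, by simp only [h0], by simp only [h1], fun t ht => ?_, fun t ht => ?_⟩
  · refine HasDerivAt.congr_deriv
      (((hasDerivAt_id' t).const_mul P).sub ((hH t).const_mul M)) ?_
    ring
  · have := mul_le_mul_of_nonneg_left (hb t ht).2 hM
    rcases max_choice α β with e | e <;> rw [e] at this <;> linarith
  · rw [abs_neg, abs_mul, abs_of_nonneg hM]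
    nlinarith [kb t ht]

theorem isMonotoneHermiteIncrement_MstarR {a b c : ℝ} (ha : 0 ≤ a) (hb : 0 ≤ b) (hc : 0 < c) :
    IsMonotoneHermiteIncrement a b (1.2 * MstarR a b c) c := by
  unfold MstarR
  split_ifs with h
  · obtain ⟨h1, h2⟩ := h
    have hpos : 0 < a ^ 2 + b ^ 2 := lt_of_lt_of_le (by positivity) h1
    set M := (a ^ 2 + b ^ 2) / (2 * c) with hMdef
    have hM : 0 < M := by positivity
    have hMc : M * (2 * c) = a ^ 2 + b ^ 2 := by rw [hMdef]; field_simp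
    have hMs : a + b ≤ M := by rw [hMdef, le_div_iff₀ (by positivity)]; linarith
    obtain ⟨x, hx, hx'⟩ := exists_isMonotoneHermiteIncrement_le le_rfl hM.le
      (div_nonneg ha hM.le) (div_nonneg hb hM.le)
      (by rw [← add_div, div_le_one hM]; exact hMs)
    have e : 0 + M * (((a / M) ^ 2 + (b / M) ^ 2) / 2) = c := by
      field_simp
      linarith
    rw [e] at hx
    rw [zero_add, zero_add, mul_div_cancel₀ _ hM.ne', mul_div_cancel₀ _ hM.ne'] at hx'
    refine hx'.of_mem_Icc (isMonotoneHermiteIncrement_linear ha hb ?_) ⟨hx, ?_⟩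
    · rw [abs_le]; constructor <;> linarith
    · nlinarith [mul_nonneg ha hb]
  · set R := Real.sqrt ((2 * c - a - b) ^ 2 + (b - a) ^ 2) with hR
    have hR0 : 0 ≤ R := Real.sqrt_nonneg _
    have hR2 : R ^ 2 = (2 * c - a - b) ^ 2 + (b - a) ^ 2 := Real.sq_sqrt (by positivity)
    have hRδ : |b - a| ≤ R := Real.abs_le_sqrt (by nlinarith [sq_nonneg (2 * c - a - b)])
    set M := |2 * c - a - b| + R with hMdef
    have hd0 := abs_nonneg (2 * c - a - b)
    have hM0 : 0 ≤ M := by positivity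
    have hδ : |b - a| ≤ M := by linarith
    obtain ⟨hδ1, hδ2⟩ := abs_le.1 hδ
    have hlin : IsMonotoneHermiteIncrement a b (1.2 * M) ((a + b) / 2) :=
      isMonotoneHermiteIncrement_linear ha hb (by linarith)
    have hquad : M ^ 2 - (b - a) ^ 2 = 2 * |2 * c - a - b| * M := by
      rw [hMdef]; nlinarith [sq_abs (2 * c - a - b)]
    rcases lt_trichotomy (2 * c - a - b) 0 with hd | hd | hd
    · rw [abs_of_neg hd] at hMdef hquad
      have hM : 0 < M := by linarith
      have hMs : M ≤ a + b := by
        have h1 : a ^ 2 + b ^ 2 < 2 * c * (a + b) := by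
          by_contra! h'
          exact h ⟨h', by linarith⟩
        have : R ≤ 2 * c := abs_le_of_sq_le_sq' (by nlinarith) (by linarith) |>.2
        linarith
      obtain ⟨x, hx, hx'⟩ := exists_isMonotoneHermiteIncrement_le
        (P := (a + b - M) / 2) (α := (M - (b - a)) / (2 * M)) (β := (M + (b - a)) / (2 * M))
        (by linarith) hM.le (div_nonneg (by linarith) (by linarith))
        (div_nonneg (by linarith) (by linarith)) (by apply le_of_eq; field_simp; ring)
      have e1 : (a + b - M) / 2 + M * ((M - (b - a)) / (2 * M)) = a := by field_simp; ring
      have e2 : (a + b - M) / 2 + M * ((M + (b - a)) / (2 * M)) = b := by field_simp; ring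
      have e3 : (a + b - M) / 2 +
          M * ((((M - (b - a)) / (2 * M)) ^ 2 + ((M + (b - a)) / (2 * M)) ^ 2) / 2) = c := by
        field_simp
        linear_combination (-2) * hquad
      rw [e1, e2] at hx'
      exact hx'.of_mem_Icc hlin ⟨hx.trans_eq e3, by linarith⟩
    · convert hlin using 1
      linarith
    · rw [abs_of_pos hd] at hMdef hquad
      have hM : 0 < M := by linarith
      have e1 : (a + b + M) / 2 - M * ((M + (b - a)) / (2 * M)) = a := by field_simp; ring
      have e2 : (a + b + M) / 2 - M * ((M - (b - a)) / (2 * M)) = b := by field_simp; ring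
      have e3 : (a + b + M) / 2 -
          M * ((((M + (b - a)) / (2 * M)) ^ 2 + ((M - (b - a)) / (2 * M)) ^ 2) / 2) = c := by
        field_simp
        linear_combination 2 * hquad
      obtain ⟨x, hx, hx'⟩ := exists_isMonotoneHermiteIncrement_ge
        (P := (a + b + M) / 2) (α := (M + (b - a)) / (2 * M)) (β := (M - (b - a)) / (2 * M))
        hM.le (div_nonneg (by linarith) (by linarith))
        (div_nonneg (by linarith) (by linarith)) (by apply le_of_eq; field_simp; ring)
        (by rwa [e1]) (by rwa [e2])
      rw [e1, e2] at hx'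
      exact hlin.of_mem_Icc hx' ⟨by linarith, e3.symm.trans_le hx⟩

/-- Near-optimal `C²` smoothing: there is a `C²` monotone Hermite interpolant for the
data `(a,b,c)` whose second derivative is bounded by `1.2 · M*(a,b,c)` on `[0,1]`. -/
theorem near_optimal_C2_smoothing
    (a b c : ℝ) (ha : 0 ≤ a) (hb : 0 ≤ b) (hc : 0 < c) :
    ∃ G g g2 : ℝ → ℝ,
      (∀ t ∈ Set.Icc (0:ℝ) 1, HasDerivWithinAt G (g t) (Set.Icc (0:ℝ) 1) t) ∧
      (∀ t ∈ Set.Icc (0:ℝ) 1, HasDerivWithinAt g (g2 t) (Set.Icc (0:ℝ) 1) t) ∧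
      ContinuousOn g2 (Set.Icc (0:ℝ) 1) ∧
      G 0 = 0 ∧ G 1 = c ∧ g 0 = a ∧ g 1 = b ∧
      (∀ t ∈ Set.Icc (0:ℝ) 1, 0 ≤ g t) ∧
      (∀ t ∈ Set.Icc (0:ℝ) 1, |g2 t| ≤ 1.2 * MstarR a b c) := by
  obtain ⟨G, g, g2, hG, hg, cg, hi, g0, g1, gn, gb⟩ :=
    isMonotoneHermiteIncrement_MstarR ha hb hc
  exact ⟨fun t => G t - G 0, g, g2, fun t _ => ((hG t).sub_const (G 0)).hasDerivWithinAt,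
    fun t _ => (hg t).hasDerivWithinAt, cg.continuousOn, sub_self _, hi, g0, g1, gn, gb⟩
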